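/- Let (A,R) be a pseudoinvolutive cotriangular Hopf algebra over k with Drinfeld element u. Then every finite-dimensional right A-comodule V can be written as a direct sum of subcomodules V = V₊ ⊕ V₋ where V₊ is positive and V₋ is negative, and this decomposition is unique: V₊ is the sum of all positive subcomodules of V and V₋ is the sum of all negative subcomodules of V. -/

import Mathlib

open TensorProduct LinearMap

noncomputable section

universe u
variable {k A : Type u} [Field k] [Ring A] [HopfAlgebra k A]

/-- The convolution product on `Hom_k(A, k)`:  `(f ∗ g)(a) = Σ f(a₁) g(a₂)`. -/
def conv1 (f g : A →ₗ[k] k) : A →ₗ[k] k :=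
  mul' k k ∘ₗ map f g ∘ₗ Coalgebra.comul

/-- The convolution product on `Hom_k(A ⊗ A, k)` (using the tensor-product coalgebra
structure of `A ⊗ A`):  `(f ∗ g)(a ⊗ b) = Σ f(a₁ ⊗ b₁) g(a₂ ⊗ b₂)`. -/
def conv2 (f g : A ⊗[k] A →ₗ[k] k) : A ⊗[k] A →ₗ[k] k :=
  mul' k k ∘ₗ map f g ∘ₗ (Coalgebra.comul : A ⊗[k] A →ₗ[k] (A ⊗[k] A) ⊗[k] (A ⊗[k] A))

/-- The counit of the coalgebra `A ⊗ A`, i.e. `a ⊗ b ↦ ε(a) ε(b)`; this is the unit of the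
convolution algebra `(A ⊗ A)*`. -/
def eps2 : A ⊗[k] A →ₗ[k] k := (Coalgebra.counit : A ⊗[k] A →ₗ[k] k)

/-- Coquasitriangularity of a linear form `R : A ⊗ A → k` with respect to a (possibly
twisted) multiplication `m` on the underlying coalgebra of `A` (with the same unit `1`):
`R` is convolution invertible and
`R(m(a⊗b) ⊗ c) = Σ R(a⊗c₁) R(b⊗c₂)`, `R(a ⊗ m(b⊗c)) = Σ R(a₁⊗c) R(a₂⊗b)`,
`R(a⊗1) = ε(a) = R(1⊗a)`, and `Σ m(b₁⊗a₁) R(a₂⊗b₂) = Σ R(a₁⊗b₁) m(a₂⊗b₂)`. -/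
structure IsCQT (m : A ⊗[k] A →ₗ[k] A) (R : A ⊗[k] A →ₗ[k] k) : Prop where
  conv_invertible : ∃ Rinv, conv2 R Rinv = eps2 ∧ conv2 Rinv R = eps2
  mul_left : R ∘ₗ map m LinearMap.id =
    mul' k k ∘ₗ map R R ∘ₗ (tensorTensorTensorComm k A A A A).toLinearMap ∘ₗ
      map LinearMap.id Coalgebra.comul
  mul_right : R ∘ₗ map LinearMap.id m =
    mul' k k ∘ₗ map R R ∘ₗ (tensorTensorTensorComm k A A A A).toLinearMap ∘ₗ
      map LinearMap.id (TensorProduct.comm k A A).toLinearMap ∘ₗ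
      map Coalgebra.comul LinearMap.id
  unit_right : ∀ a : A, R (a ⊗ₜ 1) = Coalgebra.counit a
  unit_left : ∀ a : A, R (1 ⊗ₜ a) = Coalgebra.counit a
  comm_rel : (TensorProduct.rid k A).toLinearMap ∘ₗ
      map (m ∘ₗ (TensorProduct.comm k A A).toLinearMap) R ∘ₗ
      (Coalgebra.comul : A ⊗[k] A →ₗ[k] (A ⊗[k] A) ⊗[k] (A ⊗[k] A)) =
    (TensorProduct.lid k A).toLinearMap ∘ₗ map R m ∘ₗ
      (Coalgebra.comul : A ⊗[k] A →ₗ[k] (A ⊗[k] A) ⊗[k] (A ⊗[k] A))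

/-- Cotriangularity: coquasitriangular, and the convolution inverse of `R` is `R ∘ τ`. -/
structure IsCT (m : A ⊗[k] A →ₗ[k] A) (R : A ⊗[k] A →ₗ[k] k) extends IsCQT m R : Prop where
  tri_right : conv2 R (R ∘ₗ (TensorProduct.comm k A A).toLinearMap) = eps2
  tri_left : conv2 (R ∘ₗ (TensorProduct.comm k A A).toLinearMap) R = eps2

/-- The Drinfeld element `u ∈ A*`, `u(a) = Σ R(a₂ ⊗ S(a₁))`. -/
def drinfeld (R : A ⊗[k] A →ₗ[k] k) : A →ₗ[k] k :=
  R ∘ₗ map LinearMap.id (HopfAlgebra.antipode (R := k)) ∘ₗ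
    (TensorProduct.comm k A A).toLinearMap ∘ₗ Coalgebra.comul

/-- `ρ` makes `V` into a right `A`-comodule:  `(ρ ⊗ id) ∘ ρ = (id ⊗ Δ) ∘ ρ` and
`(id ⊗ ε) ∘ ρ = id`. -/
structure IsComod (V : Type u) [AddCommGroup V] [Module k V]
    (ρ : V →ₗ[k] V ⊗[k] A) : Prop where
  coassoc : (TensorProduct.assoc k V A A).toLinearMap ∘ₗ map ρ LinearMap.id ∘ₗ ρ =
    map LinearMap.id Coalgebra.comul ∘ₗ ρ
  counit_id : (TensorProduct.rid k V).toLinearMap ∘ₗ map LinearMap.id Coalgebra.counit ∘ₗ ρ =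
    LinearMap.id

/-- The endomorphism `f|_V : v ↦ (id ⊗ f)(ρ(v))` of a right `A`-comodule `(V, ρ)` attached to a
linear form `f ∈ A*`. -/
def coact {V : Type u} [AddCommGroup V] [Module k V] (ρ : V →ₗ[k] V ⊗[k] A)
    (f : A →ₗ[k] k) : V →ₗ[k] V :=
  (TensorProduct.rid k V).toLinearMap ∘ₗ map LinearMap.id f ∘ₗ ρ

/-- Pseudoinvolutivity: `tr(S²|_C) = dim C` for every finite-dimensional subcoalgebra `C ⊆ A`. -/
def Pseudoinvolutive (k A : Type u) [Field k] [Ring A] [HopfAlgebra k A] : Prop :=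
  ∀ C : Submodule k A, FiniteDimensional k C →
    (∀ c ∈ C, Coalgebra.comul c ∈ LinearMap.range (map C.subtype C.subtype)) →
    ∀ h : ∀ x ∈ C, (HopfAlgebra.antipode (R := k) ∘ₗ HopfAlgebra.antipode (R := k)) x ∈ C,
      trace k C ((HopfAlgebra.antipode (R := k) ∘ₗ HopfAlgebra.antipode (R := k)).restrict h) =
        (Module.finrank k C : k)

/-- `c ∈ A*` is a grouplike element of the dual, i.e. an algebra homomorphism `A → k`. -/
def IsGrouplikeForm (c : A →ₗ[k] k) : Prop :=
  c 1 = 1 ∧ ∀ a b : A, c (a * b) = c a * c b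

/-- `c` is central in the convolution algebra `A*`. -/
def IsConvCentral (c : A →ₗ[k] k) : Prop :=
  ∀ f : A →ₗ[k] k, conv1 c f = conv1 f c

/-- The linear form `a ⊗ b ↦ f(a) g(b)` on `A ⊗ A`. -/
def pairForm (f g : A →ₗ[k] k) : A ⊗[k] A →ₗ[k] k := mul' k k ∘ₗ map f g

/-- The cotriangular structure
`R_c = ½ (ε⊗ε + ε⊗c + c⊗ε − c⊗c)` attached to a central grouplike `c ∈ A*` of order `≤ 2`. -/
def Rc (c : A →ₗ[k] k) : A ⊗[k] A →ₗ[k] k :=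
  (2⁻¹ : k) • (pairForm Coalgebra.counit Coalgebra.counit + pairForm Coalgebra.counit c +
    pairForm c Coalgebra.counit - pairForm c c)

/-- A submodule `W ≤ V` is a subcomodule of the comodule `(V, ρ)`. -/
def IsSubcomod {V : Type u} [AddCommGroup V] [Module k V] (ρ : V →ₗ[k] V ⊗[k] A)
    (W : Submodule k V) : Prop :=
  ∀ w ∈ W, ρ w ∈ LinearMap.range (map W.subtype (LinearMap.id : A →ₗ[k] A))

/-- A linear map between comodules is a comodule morphism. -/
def IsComodMap {V W : Type u} [AddCommGroup V] [Module k V] [AddCommGroup W] [Module k W]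
    (ρV : V →ₗ[k] V ⊗[k] A) (ρW : W →ₗ[k] W ⊗[k] A) (f : V →ₗ[k] W) : Prop :=
  ρW ∘ₗ f = map f LinearMap.id ∘ₗ ρV


/-- A subcomodule `W` of `(V, ρ)` is positive: `tr(u|_W) = dim W`. -/
def SubPos {V : Type u} [AddCommGroup V] [Module k V] (ρ : V →ₗ[k] V ⊗[k] A)
    (u : A →ₗ[k] k) (W : Submodule k V) : Prop :=
  ∃ h : ∀ x ∈ W, coact ρ u x ∈ W,
    trace k W ((coact ρ u).restrict h) = (Module.finrank k W : k)

/-- A subcomodule `W` of `(V, ρ)` is negative: `tr(u|_W) = -dim W`. -/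
def SubNeg {V : Type u} [AddCommGroup V] [Module k V] (ρ : V →ₗ[k] V ⊗[k] A)
    (u : A →ₗ[k] k) (W : Submodule k V) : Prop :=
  ∃ h : ∀ x ∈ W, coact ρ u x ∈ W,
    trace k W ((coact ρ u).restrict h) = -(Module.finrank k W : k)

/-- The convolution algebra `A*`. -/
abbrev DualAlg (k A : Type u) [Field k] [Ring A] [HopfAlgebra k A] : Type u :=
  WithConv (A →ₗ[k] k)

/-- A square matrix over `A` is a comatrix if `Δ(tᵢⱼ) = Σ tᵢₗ ⊗ tₗⱼ` and `ε(tᵢⱼ) = δᵢⱼ`. -/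
structure IsComatrix {n : Type*} [Fintype n] [DecidableEq n] (T : n → n → A) : Prop where
  comul : ∀ i j, Coalgebra.comul (R := k) (T i j) = ∑ l, T i l ⊗ₜ[k] T l j
  counit : ∀ i j, Coalgebra.counit (R := k) (T i j) = if i = j then 1 else 0

/-- The form `v(a) = Σ R(a₁ ⊗ S(a₂))`, inverse to the Drinfeld element. -/
def drinfeldInv (R : A ⊗[k] A →ₗ[k] k) : A →ₗ[k] k :=
  R ∘ₗ map LinearMap.id (HopfAlgebra.antipode (R := k)) ∘ₗ Coalgebra.comul

/-- `R(S(x) ⊗ y) = R(y ⊗ x)` for a cotriangular structure `R`. -/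
lemma IsCT.antipode_left {R : A ⊗[k] A →ₗ[k] k} (hR : IsCT (mul' k A) R) (x y : A) :
    R (HopfAlgebra.antipode k x ⊗ₜ y) = R (y ⊗ₜ x) := by
  have h1 : WithConv.toConv (R ∘ₗ map (HopfAlgebra.antipode k) LinearMap.id) *
      WithConv.toConv R = 1 := by
    ext a b
    have := fun a' a'' => LinearMap.congr_fun hR.mul_left ((a' ⊗ₜ a'') ⊗ₜ b)
    simp only [comp_apply, map_tmul, mul'_apply, id_apply, ← (Coalgebra.Repr.arbitrary k b).eq,
      tmul_sum, map_sum, LinearEquiv.coe_coe, tensorTensorTensorComm_tmul] at this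
    simp only [AlgebraTensorModule.curry_apply, restrictScalars_self, curry_apply]
    rw [((Coalgebra.Repr.arbitrary k a).tmul (Coalgebra.Repr.arbitrary k b)).convMul_apply]
    simp [Finset.sum_product, ← this]
    rw [← map_sum, ← sum_tmul, HopfAlgebra.sum_antipode_mul_eq_smul]
    simp [← smul_tmul', hR.unit_left, mul_comm]
  have h2 : WithConv.toConv R *
      WithConv.toConv (R ∘ₗ (TensorProduct.comm k A A).toLinearMap) = 1 :=
    WithConv.ext hR.tri_right
  have := left_inv_eq_right_inv h1 h2
  simpa using DFunLike.congr_fun (congrArg WithConv.ofConv this) (x ⊗ₜ y)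

section Comatrix

variable {n : Type*} [Fintype n] [DecidableEq n] {T : n → n → A}

local notation "S" => HopfAlgebra.antipode k

lemma IsComatrix.sum_antipode_mul (hT : IsComatrix (k := k) T) (i j : n) :
    ∑ l, S (T i l) * T l j = if i = j then 1 else 0 := by
  have := HopfAlgebra.mul_antipode_rTensor_comul_apply (R := k) (T i j)
  simpa [hT.comul, hT.counit, apply_ite] using this

lemma IsComatrix.sum_mul_antipode (hT : IsComatrix (k := k) T) (i j : n) :
    ∑ l, T i l * S (T l j) = if i = j then 1 else 0 := by
  have := HopfAlgebra.mul_antipode_lTensor_comul_apply (R := k) (T i j)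
  simpa [hT.comul, hT.counit, apply_ite] using this

lemma IsComatrix.comul_antipode (hT : IsComatrix (k := k) T) (i j : n) :
    Coalgebra.comul (R := k) (S (T i j)) = ∑ l, S (T l j) ⊗ₜ[k] S (T i l) := by
  let D : Matrix n n (A ⊗[k] A) := Matrix.of fun i j => Coalgebra.comul (R := k) (T i j)
  let F : Matrix n n (A ⊗[k] A) := Matrix.of fun i j => Coalgebra.comul (R := k) (S (T i j))
  let G : Matrix n n (A ⊗[k] A) := Matrix.of fun i j => ∑ l, S (T l j) ⊗ₜ[k] S (T i l)
  have hF : D * F = 1 := by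
    ext i j
    simp only [D, F, Matrix.mul_apply, Matrix.of_apply, ← Bialgebra.comul_mul, ← map_sum,
      hT.sum_mul_antipode, Matrix.one_apply]
    split_ifs <;> simp
  have hG : G * D = 1 := by
    ext i j
    have h (x y : n) : ∑ l, S (T x l) * T l y = if x = y then 1 else 0 :=
      hT.sum_antipode_mul x y
    simp only [D, G, Matrix.mul_apply, Matrix.of_apply, hT.comul, Finset.sum_mul_sum,
      Algebra.TensorProduct.tmul_mul_tmul, Matrix.one_apply]
    calc ∑ x, ∑ p, ∑ m, (S (T p x) * T x m) ⊗ₜ[k] (S (T i p) * T m j)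
        = ∑ p, ∑ m, (∑ x, S (T p x) * T x m) ⊗ₜ[k] (S (T i p) * T m j) := by
          simp only [sum_tmul]
          rw [Finset.sum_comm]
          exact Finset.sum_congr rfl fun _ _ => Finset.sum_comm
      _ = 1 ⊗ₜ[k] ∑ p, S (T i p) * T p j := by
          simp [h, ite_tmul, ← tmul_sum]
      _ = _ := by rw [h]; split_ifs <;> simp [Algebra.TensorProduct.one_def]
  have := left_inv_eq_right_inv hG hF
  exact (congrFun (congrFun this i) j).symm

lemma IsComatrix.drinfeld_apply (hT : IsComatrix (k := k) T) (R : A ⊗[k] A →ₗ[k] k) (i j : n) :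
    drinfeld R (T i j) = ∑ l, R (T l j ⊗ₜ S (T i l)) := by
  simp [drinfeld, hT.comul]

lemma IsComatrix.drinfeldInv_apply (hT : IsComatrix (k := k) T) (R : A ⊗[k] A →ₗ[k] k) (i j : n) :
    drinfeldInv R (T i j) = ∑ l, R (T i l ⊗ₜ S (T l j)) := by
  simp [drinfeldInv, hT.comul]

lemma IsComatrix.trace_drinfeldInv (hT : IsComatrix (k := k) T) (R : A ⊗[k] A →ₗ[k] k) :
    ∑ i, drinfeldInv R (T i i) = ∑ i, drinfeld R (T i i) := by
  simp only [hT.drinfeld_apply, hT.drinfeldInv_apply]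
  exact Finset.sum_comm

lemma IsComatrix.drinfeld_smul_one (hT : IsComatrix (k := k) T) {R : A ⊗[k] A →ₗ[k] k}
    (hR : IsCT (mul' k A) R) (i j : n) :
    drinfeld R (T i j) • (1 : A) = ∑ p, ∑ r, drinfeld R (T p r) • (T r j * S (T i p)) := by
  have key (q : n) := LinearMap.congr_fun hR.comm_rel (T q j ⊗ₜ S (T i q))
  simp only [comp_apply, TensorProduct.comul_tmul, hT.comul, hT.comul_antipode, sum_tmul,
    tmul_sum, map_sum, AlgebraTensorModule.tensorTensorTensorComm_tmul, map_tmul,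
    LinearEquiv.coe_coe, comm_tmul, mul'_apply, rid_tmul, lid_tmul] at key
  calc drinfeld R (T i j) • (1 : A)
      = ∑ p, ∑ r, R (T r j ⊗ₜ S (T i p)) • ∑ q, S (T p q) * T q r := by
        simp [hT.drinfeld_apply, hT.sum_antipode_mul, Finset.sum_smul]
    _ = ∑ q, ∑ p, ∑ r, R (T r j ⊗ₜ S (T i p)) • (S (T p q) * T q r) := by
        simp only [Finset.smul_sum]
        exact Finset.sum_comm_cycle
    _ = ∑ q, ∑ p, ∑ r, R (T q r ⊗ₜ S (T p q)) • (T r j * S (T i p)) :=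
        Finset.sum_congr rfl fun q _ => key q
    _ = _ := by
        simp only [hT.drinfeld_apply, Finset.sum_smul]
        exact Finset.sum_comm_cycle.symm

/-- `Σ u(a₁) a₂ = Σ S²(a₁) u(a₂)`. -/
lemma IsComatrix.sum_drinfeld_smul (hT : IsComatrix (k := k) T) {R : A ⊗[k] A →ₗ[k] k}
    (hR : IsCT (mul' k A) R) (i j : n) :
    ∑ l, drinfeld R (T i l) • T l j = ∑ l, drinfeld R (T l j) • S (S (T i l)) := by
  have h (x y : n) : ∑ l, S (T l x) * S (S (T y l)) = if y = x then 1 else 0 := by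
    simp only [← HopfAlgebra.antipode_mul_antidistrib, ← map_sum, hT.sum_antipode_mul]
    split_ifs <;> simp
  calc ∑ l, drinfeld R (T i l) • T l j
      = ∑ p, ∑ r, drinfeld R (T p r) • (T r j * ∑ l, S (T l p) * S (S (T i l))) := by
        simp [h]
    _ = ∑ l, (∑ p, ∑ r, drinfeld R (T p r) • (T r j * S (T l p))) * S (S (T i l)) := by
        simp only [Finset.mul_sum, Finset.smul_sum, Finset.sum_mul, smul_mul_assoc, mul_assoc]
        exact Finset.sum_comm_cycle
    _ = _ := by simp [← hT.drinfeld_smul_one hR]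

/-- `v ∗ u = ε`. -/
lemma IsComatrix.sum_drinfeldInv_mul_drinfeld (hT : IsComatrix (k := k) T)
    {R : A ⊗[k] A →ₗ[k] k} (hR : IsCT (mul' k A) R) (i j : n) :
    ∑ l, drinfeldInv R (T i l) * drinfeld R (T l j) = if i = j then 1 else 0 := by
  have hV (l : n) : drinfeldInv R (T i l) = ∑ p, R (S (S (T p l)) ⊗ₜ T i p) := by
    rw [hT.drinfeldInv_apply]
    exact Finset.sum_congr rfl fun p _ => (hR.antipode_left _ _).symm
  have hmul (m p : n) :
      R (T m j ⊗ₜ (T i p * S (T p m))) = ∑ l, R (T m l ⊗ₜ S (T p m)) * R (T l j ⊗ₜ T i p) := by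
    have := LinearMap.congr_fun hR.mul_right (T m j ⊗ₜ (T i p ⊗ₜ S (T p m)))
    simpa [hT.comul, sum_tmul] using this
  calc ∑ l, drinfeldInv R (T i l) * drinfeld R (T l j)
      = ∑ p, R ((∑ l, drinfeld R (T l j) • S (S (T p l))) ⊗ₜ T i p) := by
        simp only [hV, sum_tmul, map_sum, Finset.sum_mul, ← smul_tmul', map_smul, smul_eq_mul]
        rw [Finset.sum_comm]
        simp only [mul_comm]
    _ = ∑ p, ∑ l, ∑ m, R (T m l ⊗ₜ S (T p m)) * R (T l j ⊗ₜ T i p) := by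
        simp only [← hT.sum_drinfeld_smul hR]
        simp only [sum_tmul, map_sum, ← smul_tmul', map_smul, smul_eq_mul, hT.drinfeld_apply,
          Finset.sum_mul]
    _ = ∑ m, R (T m j ⊗ₜ ∑ p, T i p * S (T p m)) := by
        simp only [tmul_sum, map_sum, hmul]
        exact Finset.sum_comm_cycle
    _ = _ := by
        simp [hT.sum_mul_antipode, hR.unit_right, hT.counit, apply_ite]

end Comatrix

section ModuleTrace

variable {Γ : Type*} [Ring Γ] [Algebra k Γ]
  (M : Type*) [AddCommGroup M] [Module k M] [Module Γ M] [IsScalarTower k Γ M]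

variable (k Γ) in
/-- The annihilator of a `Γ`-module, as a `k`-subspace of `Γ`. -/
def actKer : Submodule k Γ :=
  LinearMap.ker (Algebra.lsmul k k M : Γ →ₐ[k] Module.End k M).toLinearMap

variable {M} in
lemma mem_actKer {x : Γ} : x ∈ actKer k Γ M ↔ ∀ m : M, x • m = 0 := by
  simp [actKer, LinearMap.ext_iff]

variable (k) in
/-- The map `x ↦ w x v`. -/
def conjMap (w v : Γ) : Γ →ₗ[k] Γ := mulLeft k w ∘ₗ mulRight k v

lemma conjMap_apply (w v x : Γ) : conjMap k w v x = w * (x * v) := rfl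

lemma actKer_le_comap_conjMap (w v : Γ) :
    actKer k Γ M ≤ (actKer k Γ M).comap (conjMap k w v) := fun x hx => by
  rw [mem_actKer] at hx
  simp [mem_actKer, conjMap_apply, mul_smul, hx]

variable (k) in
/-- The map `x ↦ w x v` on the quotient of `Γ` by the annihilator of a module. -/
def conjQuot (w v : Γ) : (Γ ⧸ actKer k Γ M) →ₗ[k] Γ ⧸ actKer k Γ M :=
  (actKer k Γ M).mapQ (actKer k Γ M) (conjMap k w v) (actKer_le_comap_conjMap M w v)

variable (k) in
/-- The trace of the action of `x ∈ Γ` on a module. -/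
def actTrace (x : Γ) : k := trace k M (Algebra.lsmul k k M x)

variable (k) in
/-- The action of `w` on `M` is inverse to that of `v` and has the same trace, and the trace of
`x ↦ w x v` on the image of `Γ` in `End M` is the dimension of that image. -/
structure IsInvolutivePair (w v : Γ) : Prop where
  smul_left : ∀ m : M, v • w • m = m
  smul_right : ∀ m : M, w • v • m = m
  actTrace_eq : actTrace k M v = actTrace k M w
  trace_conjQuot : trace k _ (conjQuot k M w v) = Module.finrank k (Γ ⧸ actKer k Γ M)

end ModuleTrace

section Rational

lemma TensorProduct.eq_of_forall_map_eq {K X Y : Type*} [Field K] [AddCommGroup X] [Module K X]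
    [AddCommGroup Y] [Module K Y] {x y : X ⊗[K] Y}
    (h : ∀ (f : X →ₗ[K] K) (g : Y →ₗ[K] K), mul' K K (map f g x) = mul' K K (map f g y)) :
    x = y := by
  let b := Module.Free.chooseBasis K X
  let c := Module.Free.chooseBasis K Y
  refine (b.tensorProduct c).ext_elem fun ⟨i, j⟩ => ?_
  have key (z : X ⊗[K] Y) : (b.tensorProduct c).repr z (i, j) =
      mul' K K (map (b.coord i) (c.coord j) z) := by
    induction z with
    | zero => simp
    | tmul a d => simp [Module.Basis.tensorProduct_repr_tmul_apply, mul_comm]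
    | add a d ha hd => simp [ha, hd]
  rw [key, key, h]

variable (k A) in
/-- A module over the convolution algebra `A*` is rational if its matrix coefficients are
evaluations at elements of `A`. -/
def IsRational (M : Type*) [AddCommGroup M] [Module k M] [Module (DualAlg k A) M] : Prop :=
  ∀ (m : M) (φ : M →ₗ[k] k), ∃ a : A, ∀ f : DualAlg k A, φ (f • m) = f.ofConv a

variable {M N : Type*} [AddCommGroup M] [Module k M] [Module (DualAlg k A) M]
  [AddCommGroup N] [Module k N] [Module (DualAlg k A) N]

lemma IsRational.of_injective (hN : IsRational k A N) (i : M →ₗ[k] N)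
    (hi : Function.Injective i) (h : ∀ (f : DualAlg k A) m, i (f • m) = f • i m) :
    IsRational k A M := fun m φ => by
  obtain ⟨r, hr⟩ := i.exists_leftInverse_of_injective (LinearMap.ker_eq_bot.mpr hi)
  obtain ⟨a, ha⟩ := hN (i m) (φ ∘ₗ r)
  refine ⟨a, fun f => ?_⟩
  rw [← ha, ← h]
  exact congrArg φ (LinearMap.congr_fun hr _).symm

lemma IsRational.of_surjective (hM : IsRational k A M) (p : M →ₗ[k] N)
    (hp : Function.Surjective p) (h : ∀ (f : DualAlg k A) m, p (f • m) = f • p m) :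
    IsRational k A N := fun n φ => by
  obtain ⟨m, rfl⟩ := hp n
  obtain ⟨a, ha⟩ := hM m (φ ∘ₗ p)
  exact ⟨a, fun f => by rw [← ha, ← h]; rfl⟩

lemma IsRational.prod (hM : IsRational k A M) (hN : IsRational k A N) :
    IsRational k A (M × N) := fun m φ => by
  obtain ⟨a, ha⟩ := hM m.1 (φ ∘ₗ LinearMap.inl k M N)
  obtain ⟨b, hb⟩ := hN m.2 (φ ∘ₗ LinearMap.inr k M N)
  refine ⟨a + b, fun f => ?_⟩
  rw [map_add, ← ha, ← hb]
  simp only [comp_apply, inl_apply, inr_apply, ← map_add]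
  congr 1
  ext <;> simp

variable [IsScalarTower k (DualAlg k A) M]

lemma IsRational.exists_comatrix (hM : IsRational k A M) {n : Type*} [Fintype n] [DecidableEq n]
    (b : Module.Basis n k M) : ∃ T : n → n → A, IsComatrix (k := k) T ∧
      ∀ (f : DualAlg k A) i j, toMatrix b b (Algebra.lsmul k k M f) i j = f.ofConv (T i j) := by
  choose T hT using fun i j => hM (b j) (b.coord i)
  refine ⟨T, ⟨fun i j => ?_, fun i j => ?_⟩, fun f i j => ?_⟩
  · refine TensorProduct.eq_of_forall_map_eq fun f g => ?_
    have h1 := hT i j (WithConv.toConv f * WithConv.toConv g)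
    rw [LinearMap.convMul_apply] at h1
    refine h1.symm.trans ?_
    rw [mul_smul, ← b.sum_repr (WithConv.toConv g • b j)]
    simp only [Finset.smul_sum, map_sum, map_tmul, mul'_apply]
    refine Finset.sum_congr rfl fun l _ => ?_
    rw [smul_algebra_smul_comm, map_smul, hT, smul_eq_mul, mul_comm]
    congr 1
    exact hT l j _
  · have h1 := hT i j 1
    rw [LinearMap.convOne_apply] at h1
    simp only [one_smul, Module.Basis.coord_apply, Module.Basis.repr_self] at h1
    simpa [Finsupp.single_apply, eq_comm] using h1.symm
  · rw [← hT]
    simp [toMatrix_apply]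

end Rational

section Rational

variable {M : Type*} [AddCommGroup M] [Module k M] [Module (DualAlg k A) M]
  [IsScalarTower k (DualAlg k A) M]

lemma IsComatrix.toConv_mul_apply {n : Type*} [Fintype n] [DecidableEq n] {T : n → n → A}
    (hT : IsComatrix (k := k) T) (f g : DualAlg k A) (i j : n) :
    (f * g).ofConv (T i j) = ∑ l, f.ofConv (T i l) * g.ofConv (T l j) := by
  rw [LinearMap.convMul_apply]
  simp [hT.comul]

/-- `Σ u(a₁) a₂ v(a₃) = S²(a)`. -/
lemma IsComatrix.antipode_antipode {n : Type*} [Fintype n] [DecidableEq n] {T : n → n → A}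
    (hT : IsComatrix (k := k) T) {R : A ⊗[k] A →ₗ[k] k} (hR : IsCT (mul' k A) R) (i j : n) :
    HopfAlgebra.antipode k (HopfAlgebra.antipode k (T i j)) =
      ∑ l, ∑ m, (drinfeld R (T i l) * drinfeldInv R (T m j)) • T l m := by
  have hUV : (Matrix.of fun i j => drinfeldInv R (T i j)) *
      (Matrix.of fun i j => drinfeld R (T i j)) = 1 := by
    ext i j
    simpa [Matrix.mul_apply, Matrix.one_apply] using hT.sum_drinfeldInv_mul_drinfeld hR i j
  have hVU' := mul_eq_one_comm.mp hUV
  have hVU (p : n) : ∑ m, drinfeld R (T p m) * drinfeldInv R (T m j) = if p = j then 1 else 0 := by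
    simpa [Matrix.mul_apply, Matrix.one_apply] using
      congrFun (congrFun hVU' p) j
  calc HopfAlgebra.antipode k (HopfAlgebra.antipode k (T i j))
      = ∑ p, (∑ m, drinfeld R (T p m) * drinfeldInv R (T m j)) •
          HopfAlgebra.antipode k (HopfAlgebra.antipode k (T i p)) := by simp [hVU]
    _ = ∑ m, drinfeldInv R (T m j) • ∑ p, drinfeld R (T p m) •
          HopfAlgebra.antipode k (HopfAlgebra.antipode k (T i p)) := by
        simp only [Finset.sum_smul, Finset.smul_sum, smul_smul, mul_comm]
        exact Finset.sum_comm
    _ = ∑ m, ∑ l, (drinfeld R (T i l) * drinfeldInv R (T m j)) • T l m := by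
        simp only [← hT.sum_drinfeld_smul hR, Finset.smul_sum, smul_smul, mul_comm]
    _ = _ := Finset.sum_comm

lemma IsRational.trace_conjQuot (hM : IsRational k A M) [FiniteDimensional k M]
    {R : A ⊗[k] A →ₗ[k] k} (hR : IsCT (mul' k A) R) (hpi : Pseudoinvolutive k A) :
    trace k _ (conjQuot k M (WithConv.toConv (drinfeld R) : DualAlg k A)
      (WithConv.toConv (drinfeldInv R))) =
      Module.finrank k (DualAlg k A ⧸ actKer k (DualAlg k A) M) := by
  obtain ⟨T, hT, hTb⟩ := hM.exists_comatrix (Module.finBasis k M)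
  let C : Submodule k A := Submodule.span k (Set.range fun p : Fin _ × Fin _ => T p.1 p.2)
  have hTC (i j) : T i j ∈ C := Submodule.subset_span ⟨(i, j), rfl⟩
  have hC : FiniteDimensional k C := FiniteDimensional.span_of_finite k (Set.finite_range _)
  have hcomul : ∀ c ∈ C, Coalgebra.comul c ∈ LinearMap.range (map C.subtype C.subtype) := by
    change C ≤ (LinearMap.range _).comap Coalgebra.comul
    refine Submodule.span_le.mpr ?_
    rintro _ ⟨⟨i, j⟩, rfl⟩
    refine ⟨∑ l, ⟨T i l, hTC i l⟩ ⊗ₜ ⟨T l j, hTC l j⟩, ?_⟩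
    simp [hT.comul]
  have hS : ∀ x ∈ C, (HopfAlgebra.antipode k ∘ₗ HopfAlgebra.antipode k) x ∈ C := by
    change C ≤ C.comap (HopfAlgebra.antipode k ∘ₗ HopfAlgebra.antipode k)
    refine Submodule.span_le.mpr ?_
    rintro _ ⟨⟨i, j⟩, rfl⟩
    simp only [SetLike.mem_coe, Submodule.mem_comap, comp_apply, hT.antipode_antipode hR]
    exact C.sum_mem fun l _ => C.sum_mem fun m _ => C.smul_mem _ (hTC l m)
  let res : DualAlg k A →ₗ[k] Module.Dual k C :=
    { toFun := fun f => f.ofConv ∘ₗ C.subtype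
      map_add' := fun f g => rfl
      map_smul' := fun c f => rfl }
  have hres : Function.Surjective res := fun φ => by
    obtain ⟨g, hg⟩ := φ.exists_extend
    exact ⟨WithConv.toConv g, hg⟩
  have hker : LinearMap.ker res = actKer k (DualAlg k A) M := by
    ext f
    have : f ∈ actKer k (DualAlg k A) M ↔ ∀ i j, f.ofConv (T i j) = 0 := by
      rw [actKer, LinearMap.mem_ker, ← (toMatrix (Module.finBasis k M)
        (Module.finBasis k M)).map_eq_zero_iff]
      simp only [← hTb]
      exact ⟨fun h i j => congrFun (congrFun h i) j, fun h => Matrix.ext h⟩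
    rw [this, LinearMap.mem_ker]
    constructor
    · exact fun h i j => LinearMap.congr_fun h ⟨_, hTC i j⟩
    · intro h
      have : C ≤ LinearMap.ker f.ofConv := Submodule.span_le.mpr (by
        rintro _ ⟨⟨i, j⟩, rfl⟩
        exact h i j)
      ext x
      exact this x.2
  let e : (DualAlg k A ⧸ actKer k (DualAlg k A) M) ≃ₗ[k] Module.Dual k C :=
    (Submodule.quotEquivOfEq _ _ hker.symm).trans (res.quotKerEquivOfSurjective hres)
  have he : e.conj (conjQuot k M (WithConv.toConv (drinfeld R) : DualAlg k A)
      (WithConv.toConv (drinfeldInv R))) = Module.Dual.transpose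
        ((HopfAlgebra.antipode k ∘ₗ HopfAlgebra.antipode k).restrict hS) := by
    refine LinearMap.ext fun φ => ?_
    obtain ⟨x, rfl⟩ := e.surjective φ
    obtain ⟨f, rfl⟩ := Submodule.Quotient.mk_surjective _ x
    rw [LinearEquiv.conj_apply_apply, LinearEquiv.symm_apply_apply]
    have key : C ≤ LinearMap.eqLocus
        (WithConv.toConv (drinfeld R) * (f * WithConv.toConv (drinfeldInv R))).ofConv
        (f.ofConv ∘ₗ HopfAlgebra.antipode k ∘ₗ HopfAlgebra.antipode k) := by
      refine Submodule.span_le.mpr ?_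
      rintro _ ⟨⟨i, j⟩, rfl⟩
      simp only [SetLike.mem_coe, LinearMap.mem_eqLocus, hT.toConv_mul_apply, comp_apply,
        hT.antipode_antipode hR, map_sum, map_smul, Finset.mul_sum, smul_eq_mul]
      refine Finset.sum_congr rfl fun l _ => Finset.sum_congr rfl fun m _ => ?_
      ring
    ext ⟨x, hx⟩
    exact key hx
  rw [← LinearMap.trace_conj' _ e, he, LinearMap.trace_transpose', hpi C hC hcomul hS, e.finrank_eq,
    Subspace.dual_finrank_eq]

lemma IsRational.isInvolutivePair (hM : IsRational k A M) [FiniteDimensional k M]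
    {R : A ⊗[k] A →ₗ[k] k} (hR : IsCT (mul' k A) R) (hpi : Pseudoinvolutive k A) :
    IsInvolutivePair k M (WithConv.toConv (drinfeld R) : DualAlg k A)
      (WithConv.toConv (drinfeldInv R)) := by
  obtain ⟨T, hT, hTb⟩ := hM.exists_comatrix (Module.finBasis k M)
  have h : Algebra.lsmul k k M (WithConv.toConv (drinfeldInv R) : DualAlg k A) *
      Algebra.lsmul k k M (WithConv.toConv (drinfeld R) : DualAlg k A) = 1 := by
    rw [← map_mul]
    refine (toMatrix (Module.finBasis k M) (Module.finBasis k M)).injective ?_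
    ext i j
    rw [hTb, hT.toConv_mul_apply, LinearMap.toMatrix_one, Matrix.one_apply]
    exact hT.sum_drinfeldInv_mul_drinfeld hR i j
  refine ⟨LinearMap.congr_fun h, LinearMap.congr_fun (mul_eq_one_comm.mp h), ?_,
    hM.trace_conjQuot hR hpi⟩
  rw [actTrace, actTrace, LinearMap.trace_eq_matrix_trace k (Module.finBasis k M),
    LinearMap.trace_eq_matrix_trace k (Module.finBasis k M)]
  simp only [Matrix.trace, Matrix.diag, hTb]
  exact hT.trace_drinfeldInv R

end Rational

section LinearAlgebra

section

variable {K X Y : Type*} [CommRing K] [AddCommGroup X] [Module K X] [AddCommGroup Y] [Module K Y]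

/-- The map `f ↦ a f b` on linear maps. -/
def LinearMap.sandwich (a : Module.End K Y) (b : Module.End K X) : Module.End K (X →ₗ[K] Y) :=
  (LinearMap.lcomp K Y b) ∘ₗ (a.compRight K)

lemma LinearMap.sandwich_apply (a : Module.End K Y) (b : Module.End K X) (f : X →ₗ[K] Y) :
    sandwich a b f = a ∘ₗ f ∘ₗ b := rfl

lemma LinearMap.trace_sandwich [Module.Free K X] [Module.Finite K X]
    [Module.Free K Y] [Module.Finite K Y]
    (a : Module.End K Y) (b : Module.End K X) :
    trace K _ (sandwich a b) = trace K Y a * trace K X b := by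
  have : (dualTensorHomEquiv K X Y).conj (map (Module.Dual.transpose b) a) = sandwich a b := by
    refine LinearMap.ext fun f => ?_
    obtain ⟨t, rfl⟩ := (dualTensorHomEquiv K X Y).surjective f
    rw [LinearEquiv.conj_apply_apply, LinearEquiv.symm_apply_apply]
    induction t with
    | zero => simp
    | add s t hs ht => simp only [map_add, hs, ht]
    | tmul φ y =>
      ext x
      simp [sandwich_apply, dualTensorHom_apply, Module.Dual.transpose_apply]
  rw [← this]
  refine (LinearMap.trace_conj' (R := K) (M := Module.Dual K X ⊗[K] Y) (N := X →ₗ[K] Y)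
    (map (Module.Dual.transpose b) a) (dualTensorHomEquiv K X Y)).trans ?_
  rw [LinearMap.trace_tensorProduct', LinearMap.trace_transpose', mul_comm]

end

variable {K : Type*} [Field K]

lemma LinearMap.trace_eq_add_of_exact {X Y Z : Type*} [AddCommGroup X] [Module K X]
    [AddCommGroup Y] [Module K Y] [AddCommGroup Z] [Module K Z] [FiniteDimensional K X]
    [FiniteDimensional K Y] [FiniteDimensional K Z]
    {i : X →ₗ[K] Y} {p : Y →ₗ[K] Z} (hi : Function.Injective i) (hp : Function.Surjective p)
    (hip : Function.Exact i p) {f : Module.End K X} {g : Module.End K Y} {h : Module.End K Z}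
    (hfg : g ∘ₗ i = i ∘ₗ f) (hgh : p ∘ₗ g = h ∘ₗ p) :
    trace K Y g = trace K X f + trace K Z h := by
  obtain ⟨s, hs⟩ := p.exists_rightInverse_of_surjective (LinearMap.range_eq_top.mpr hp)
  obtain ⟨l, hl⟩ := i.exists_leftInverse_of_injective (LinearMap.ker_eq_bot.mpr hi)
  have hs' (z : Z) : p (s z) = z := LinearMap.congr_fun hs z
  have hl' (x : X) : l (i x) = x := LinearMap.congr_fun hl x
  let q : Y →ₗ[K] X := l ∘ₗ (LinearMap.id - s ∘ₗ p)
  have hq (y : Y) : i (q y) = y - s (p y) := by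
    obtain ⟨x, hx⟩ := (hip (y - s (p y))).mp (by simp [hs'])
    change i (l (y - s (p y))) = _
    rw [← hx, hl']
  have hqi : q ∘ₗ i = LinearMap.id := by
    ext x
    refine hi ?_
    simp [hq, hip.apply_apply_eq_zero]
  have hg : g = (i ∘ₗ f) ∘ₗ q + (g ∘ₗ s) ∘ₗ p := by
    ext y
    simp [← hfg, hq]
  calc trace K Y g = trace K Y ((i ∘ₗ f) ∘ₗ q) + trace K Y ((g ∘ₗ s) ∘ₗ p) := by
        rw [← map_add, ← hg]
    _ = trace K X (q ∘ₗ i ∘ₗ f) + trace K Z (p ∘ₗ g ∘ₗ s) := by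
        rw [LinearMap.trace_comp_comm' (i ∘ₗ f) q, LinearMap.trace_comp_comm' (g ∘ₗ s) p]
    _ = _ := by
        rw [← LinearMap.comp_assoc, hqi, ← LinearMap.comp_assoc, hgh, LinearMap.comp_assoc, hs]
        simp

lemma LinearMap.finrank_eq_add_of_exact {X Y Z : Type*} [AddCommGroup X] [Module K X]
    [AddCommGroup Y] [Module K Y] [AddCommGroup Z] [Module K Z] [FiniteDimensional K Y]
    {i : X →ₗ[K] Y} {p : Y →ₗ[K] Z} (hi : Function.Injective i) (hp : Function.Surjective p)
    (hip : Function.Exact i p) :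
    Module.finrank K Y = Module.finrank K X + Module.finrank K Z := by
  rw [← LinearMap.finrank_range_add_finrank_ker p, LinearMap.range_eq_top.mpr hp, finrank_top,
    LinearMap.exact_iff.mp hip, LinearMap.finrank_range_of_inj hi, add_comm]

variable {X Y : Type*} [AddCommGroup X] [Module K X] [AddCommGroup Y] [Module K Y]

/-- A nonzero subspace of `Hom(X, Y)` stable under all maps `f ↦ a f b` is everything. -/
lemma LinearMap.submodule_eq_top_of_sandwich_mem [FiniteDimensional K X] [FiniteDimensional K Y]
    (F : Submodule K (X →ₗ[K] Y)) {f : X →ₗ[K] Y} (hf : f ∈ F) (hf0 : f ≠ 0)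
    (hF : ∀ a b, ∀ g ∈ F, sandwich a b g ∈ F) : F = ⊤ := by
  obtain ⟨x, hx⟩ : ∃ x, f x ≠ 0 := by
    by_contra! h
    exact hf0 (LinearMap.ext h)
  obtain ⟨χ, hχ⟩ := Module.Projective.exists_dual_ne_zero K hx
  refine eq_top_iff.mpr fun g _ => ?_
  obtain ⟨t, rfl⟩ := (dualTensorHomEquiv K X Y).surjective g
  induction t with
  | zero => simp
  | add s t hs ht =>
    rw [map_add]
    exact F.add_mem (hs trivial) (ht trivial)
  | tmul φ y =>
    convert hF ((χ (f x))⁻¹ • χ.smulRight y) (φ.smulRight x) f hf using 1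
    ext z
    simp [sandwich_apply, dualTensorHom_apply, smul_smul, hχ, mul_comm]

end LinearAlgebra

section ModuleTrace

variable {Γ : Type*} [Ring Γ] [Algebra k Γ]
  {M N W : Type*} [AddCommGroup M] [Module k M] [Module Γ M] [IsScalarTower k Γ M]
  [AddCommGroup N] [Module k N] [Module Γ N] [IsScalarTower k Γ N]
  [AddCommGroup W] [Module k W] [Module Γ W] [IsScalarTower k Γ W]

lemma actTrace_eq_add_of_exact [FiniteDimensional k W] [FiniteDimensional k M]
    [FiniteDimensional k N] {i : W →ₗ[Γ] M} {p : M →ₗ[Γ] N} (hi : Function.Injective i)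
    (hp : Function.Surjective p) (hip : Function.Exact i p) (x : Γ) :
    actTrace k M x = actTrace k W x + actTrace k N x :=
  LinearMap.trace_eq_add_of_exact (i := i.restrictScalars k) (p := p.restrictScalars k) hi hp hip
    (by ext; simp) (by ext; simp)

lemma actTrace_congr (e : M ≃ₗ[Γ] N) (x : Γ) : actTrace k M x = actTrace k N x := by
  rw [actTrace, actTrace, ← LinearMap.trace_conj' _ (e.restrictScalars k)]
  congr 1
  ext n
  simp [LinearEquiv.conj_apply_apply]

lemma toModuleEnd_surjective_of_isSimpleModule [IsAlgClosed k] [FiniteDimensional k M]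
    [IsSimpleModule Γ M] :
    Function.Surjective (Algebra.lsmul k k M : Γ →ₐ[k] Module.End k M) := fun f => by
  classical
  let F : Module.End (Module.End Γ M) M :=
    { f with
      map_smul' := fun g m => by
        obtain ⟨c, rfl⟩ := (IsSimpleModule.algebraMap_end_bijective_of_isAlgClosed k).2 g
        simp }
  obtain ⟨x, hx⟩ := jacobson_density F (Finset.univ.image (Module.finBasis k M))
  exact ⟨x, (Module.finBasis k M).ext fun i => (hx _ (by simp)).symm⟩

variable (k Γ M) in
/-- The embedding into `End M` of the quotient of `Γ` by the annihilator of `M`. -/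
def actQuot : (Γ ⧸ actKer k Γ M) →ₗ[k] Module.End k M :=
  (actKer k Γ M).liftQ (Algebra.lsmul k k M : Γ →ₐ[k] Module.End k M).toLinearMap le_rfl

lemma actQuot_mk (x : Γ) (m : M) : actQuot k Γ M (Submodule.Quotient.mk x) m = x • m := rfl

variable (k Γ M) in
lemma actQuot_injective : Function.Injective (actQuot k Γ M) :=
  LinearMap.ker_eq_bot.mp (Submodule.ker_liftQ_eq_bot' _ _ rfl)

instance [FiniteDimensional k M] : FiniteDimensional k (Γ ⧸ actKer k Γ M) :=
  .of_injective _ (actQuot_injective k Γ M)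

lemma actQuot_conjQuot (w v : Γ) (q : Γ ⧸ actKer k Γ M) :
    actQuot k Γ M (conjQuot k M w v q) =
      sandwich (Algebra.lsmul k k M w) (Algebra.lsmul k k M v) (actQuot k Γ M q) := by
  obtain ⟨x, rfl⟩ := Submodule.Quotient.mk_surjective _ q
  ext m
  change (w * (x * v)) • m = w • x • v • m
  simp only [mul_smul]

/-- On a simple module, the trace of `w` is plus or minus the dimension. -/
lemma IsInvolutivePair.actTrace_of_isSimpleModule [IsAlgClosed k] [FiniteDimensional k M]
    [IsSimpleModule Γ M] {w v : Γ} (h : IsInvolutivePair k M w v) :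
    actTrace k M w = Module.finrank k M ∨ actTrace k M w = -Module.finrank k M := by
  have hsurj : Function.Surjective (actQuot k Γ M) := fun f => by
    obtain ⟨x, rfl⟩ := toModuleEnd_surjective_of_isSimpleModule (k := k) (Γ := Γ) f
    exact ⟨Submodule.Quotient.mk x, rfl⟩
  let e := LinearEquiv.ofBijective (actQuot k Γ M) ⟨actQuot_injective k Γ M, hsurj⟩
  have he : e.conj (conjQuot k M w v) =
      sandwich (Algebra.lsmul k k M w) (Algebra.lsmul k k M v) := by
    refine LinearMap.ext fun f => ?_
    obtain ⟨q, rfl⟩ := e.surjective f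
    rw [LinearEquiv.conj_apply_apply, LinearEquiv.symm_apply_apply]
    exact actQuot_conjQuot w v q
  have h1 := h.trace_conjQuot
  rw [← LinearMap.trace_conj' _ e, he, LinearMap.trace_sandwich, e.finrank_eq] at h1
  change actTrace k M w * actTrace k M v = _ at h1
  rw [h.actTrace_eq, Module.finrank_linearMap, Nat.cast_mul] at h1
  exact mul_self_eq_mul_self_iff.mp h1

end ModuleTrace

section KernelSplitting

variable {Γ : Type*} [Ring Γ] [Algebra k Γ]
  {M N W : Type*} [AddCommGroup M] [Module k M] [Module Γ M] [IsScalarTower k Γ M]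
  [AddCommGroup N] [Module k N] [Module Γ N] [IsScalarTower k Γ N]
  [AddCommGroup W] [Module k W] [Module Γ W] [IsScalarTower k Γ W]

/-- Two simple modules without nonzero maps between them have an element acting as `1` on the
first and as `0` on the second. -/
lemma exists_smul_eq_self_smul_eq_zero [FiniteDimensional k W] [FiniteDimensional k N]
    [IsSimpleModule Γ W] [IsSimpleModule Γ N] (h : IsEmpty (W ≃ₗ[Γ] N)) :
    ∃ e : Γ, (∀ w : W, e • w = w) ∧ ∀ n : N, e • n = 0 := by
  classical
  have hWN (f : W →ₗ[Γ] N) : f = 0 :=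
    f.bijective_or_eq_zero.resolve_left fun hf => h.false (LinearEquiv.ofBijective f hf)
  have hNW (f : N →ₗ[Γ] W) : f = 0 :=
    f.bijective_or_eq_zero.resolve_left fun hf => h.false (LinearEquiv.ofBijective f hf).symm
  let F : Module.End (Module.End Γ (W × N)) (W × N) :=
    { toFun := fun m => (m.1, 0)
      map_add' := fun m m' => by simp
      map_smul' := fun g m => by
        have h1 (w : W) : (g (w, 0)).2 = 0 :=
          LinearMap.congr_fun (hWN (LinearMap.snd Γ W N ∘ₗ g ∘ₗ LinearMap.inl Γ W N)) w
        have h2 (n : N) : (g (0, n)).1 = 0 :=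
          LinearMap.congr_fun (hNW (LinearMap.fst Γ W N ∘ₗ g ∘ₗ LinearMap.inr Γ W N)) n
        have h3 : g m = g (m.1, 0) + g (0, m.2) := by simp [← map_add]
        simp only [RingHom.id_apply, Module.End.smul_def, h3]
        ext <;> simp [h1, h2] }
  have : IsSemisimpleModule Γ (W × N) := by
    have h := IsSemisimpleModule.sup (.range (LinearMap.inl Γ W N)) (.range (LinearMap.inr Γ W N))
    rw [LinearMap.sup_range_inl_inr] at h
    exact IsSemisimpleModule.congr Submodule.topEquiv.symm
  obtain ⟨e, he⟩ := jacobson_density F (Finset.univ.image (Module.finBasis k (W × N)))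
  have key (m : W × N) : e • m = (m.1, 0) := by
    have : Algebra.lsmul k k (W × N) e = LinearMap.inl k W N ∘ₗ LinearMap.fst k W N :=
      (Module.finBasis k (W × N)).ext fun i => (he _ (by simp)).symm
    exact LinearMap.congr_fun this m
  exact ⟨e, fun w => congrArg Prod.fst (key (w, 0)), fun n => congrArg Prod.snd (key (0, n))⟩

lemma mem_actKer_prod {x : Γ} :
    x ∈ actKer k Γ (W × N) ↔ (∀ w : W, x • w = 0) ∧ ∀ n : N, x • n = 0 := by
  rw [mem_actKer]
  refine ⟨fun h => ⟨fun w => ?_, fun n => ?_⟩, fun h m => Prod.ext (h.1 _) (h.2 _)⟩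
  · simpa using h (w, 0)
  · simpa using h (0, n)

/-- If all maps `M → N → W → M` come from elements of `Γ`, then the annihilator of `W × N` modulo
that of `M` is `Hom(N, W)`. -/
lemma finrank_eq_of_forall_exists_smul_eq [FiniteDimensional k M] [FiniteDimensional k N]
    [FiniteDimensional k W] {i : W →ₗ[Γ] M} {p : M →ₗ[Γ] N} (hi : Function.Injective i)
    (hp : Function.Surjective p) (hip : Function.Exact i p) {w v : Γ}
    (hM : IsInvolutivePair k M w v) (hWN : IsInvolutivePair k (W × N) w v)
    (h : ∀ f : N →ₗ[k] W, ∃ x : Γ, ∀ m, x • m = i (f (p m))) :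
    ((Module.finrank k N * Module.finrank k W : ℕ) : k) = actTrace k W w * actTrace k N v := by
  let j : (N →ₗ[k] W) →ₗ[k] Module.End k M :=
    (LinearMap.lcomp k M (p.restrictScalars k)) ∘ₗ ((i.restrictScalars k).compRight k)
  have hj (f : N →ₗ[k] W) (m : M) : j f m = i (f (p m)) := rfl
  obtain ⟨r, hr⟩ := (actQuot k Γ M).exists_leftInverse_of_injective
    (LinearMap.ker_eq_bot.mpr (actQuot_injective k Γ M))
  have hr' (f : N →ₗ[k] W) : actQuot k Γ M (r (j f)) = j f := by
    obtain ⟨x, hx⟩ := h f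
    have : j f = actQuot k Γ M (Submodule.Quotient.mk x) := LinearMap.ext fun m => (hx m).symm
    rw [this]
    exact congrArg _ (LinearMap.congr_fun hr _)
  have hjinj : Function.Injective (r ∘ₗ j) := fun f g hfg => by
    have : j f = j g := (hr' f).symm.trans ((congrArg _ hfg).trans (hr' g))
    ext n
    obtain ⟨m, rfl⟩ := hp n
    exact hi (LinearMap.congr_fun this m)
  have hle : actKer k Γ M ≤ actKer k Γ (W × N) := fun x hx => by
    rw [mem_actKer] at hx
    refine mem_actKer_prod.mpr ⟨fun w => hi ?_, fun n => ?_⟩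
    · rw [map_smul, hx, map_zero]
    · obtain ⟨m, rfl⟩ := hp n
      rw [← map_smul, hx, map_zero]
  let q := Submodule.factor hle
  have hq : Function.Surjective q := Submodule.factor_surjective hle
  have hex : Function.Exact (r ∘ₗ j) q := fun y => by
    obtain ⟨x, rfl⟩ := Submodule.Quotient.mk_surjective _ y
    have hqx : q (Submodule.Quotient.mk x) = 0 ↔ x ∈ actKer k Γ (W × N) :=
      Submodule.Quotient.mk_eq_zero _
    rw [hqx, mem_actKer_prod]
    constructor
    · intro hx
      obtain ⟨s, hs⟩ := (p.restrictScalars k).exists_rightInverse_of_surjective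
        (LinearMap.range_eq_top.mpr hp)
      obtain ⟨l, hl⟩ := (i.restrictScalars k).exists_leftInverse_of_injective
        (LinearMap.ker_eq_bot.mpr hi)
      refine ⟨l ∘ₗ (Algebra.lsmul k k M x) ∘ₗ s, actQuot_injective k Γ M ?_⟩
      refine (hr' _).trans (LinearMap.ext fun m => ?_)
      rw [actQuot_mk, hj]
      simp only [comp_apply, Algebra.lsmul_coe]
      have hps : p (s (p m)) = p m := LinearMap.congr_fun hs _
      obtain ⟨y, hy⟩ := (hip (m - s (p m))).mp (by rw [map_sub, hps, sub_self])
      have h1 : x • m = x • s (p m) := by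
        rw [← sub_eq_zero, ← smul_sub, ← hy, ← map_smul, hx.1, map_zero]
      obtain ⟨z, hz⟩ := (hip (x • m)).mp (by rw [map_smul, hx.2])
      rw [← h1, ← hz]
      exact congrArg i (LinearMap.congr_fun hl z)
    · rintro ⟨f, hf⟩
      have hx (m : M) : x • m = i (f (p m)) := by
        rw [← actQuot_mk (k := k), ← hf]
        exact LinearMap.congr_fun (hr' f) m
      refine ⟨fun w => hi ?_, fun n => ?_⟩
      · rw [map_smul, hx, hip.apply_apply_eq_zero, map_zero, map_zero]
      · obtain ⟨m, rfl⟩ := hp n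
        rw [← map_smul, hx, hip.apply_apply_eq_zero]
  have htr := LinearMap.trace_eq_add_of_exact hjinj hq hex
    (f := sandwich (Algebra.lsmul k k W w) (Algebra.lsmul k k N v))
    (g := conjQuot k M w v) (h := conjQuot k (W × N) w v)
    (by
      refine LinearMap.ext fun f => actQuot_injective k Γ M ?_
      simp only [comp_apply]
      rw [actQuot_conjQuot, hr', hr']
      ext m
      simp [sandwich_apply, hj])
    (by
      refine LinearMap.ext fun y => ?_
      obtain ⟨x, rfl⟩ := Submodule.Quotient.mk_surjective _ y
      rfl)
  rw [hM.trace_conjQuot, hWN.trace_conjQuot, finrank_eq_add_of_exact hjinj hq hex,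
    Nat.cast_add, add_left_inj, LinearMap.trace_sandwich, Module.finrank_linearMap] at htr
  exact htr

/-- An extension of a simple module by a simple module with opposite sign of the trace of `w`
splits. -/
lemma exists_isCompl_range_of_sign [IsAlgClosed k] [CharZero k] [FiniteDimensional k M]
    [FiniteDimensional k N] [FiniteDimensional k W] [IsSimpleModule Γ W] [IsSimpleModule Γ N]
    {i : W →ₗ[Γ] M} {p : M →ₗ[Γ] N} (hi : Function.Injective i)
    (hp : Function.Surjective p) (hip : Function.Exact i p) {w v : Γ}
    (hM : IsInvolutivePair k M w v) (hWN : IsInvolutivePair k (W × N) w v)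
    (hN : IsInvolutivePair k N w v) {s : k} (hs : s * s = 1)
    (hsW : actTrace k W w = s * Module.finrank k W)
    (hsN : actTrace k N w = -(s * Module.finrank k N)) :
    ∃ Z : Submodule Γ M, IsCompl (LinearMap.range i) Z := by
  have hs0 : s ≠ 0 := fun h => by simp [h] at hs
  have := IsSimpleModule.nontrivial Γ N
  have := IsSimpleModule.nontrivial Γ W
  have hdN : (Module.finrank k N : k) ≠ 0 := Nat.cast_ne_zero.mpr Module.finrank_pos.ne'
  have hdW : (Module.finrank k W : k) ≠ 0 := Nat.cast_ne_zero.mpr Module.finrank_pos.ne'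
  have hempty : IsEmpty (W ≃ₗ[Γ] N) := ⟨fun e => by
    rw [actTrace_congr e, hsN, (e.restrictScalars k).finrank_eq, neg_eq_iff_add_eq_zero,
      ← two_mul] at hsW
    simp [hs0, hdN] at hsW⟩
  let F : Submodule k (N →ₗ[k] W) :=
    { carrier := {f | ∃ x : Γ, ∀ m, x • m = i (f (p m))}
      zero_mem' := ⟨0, by simp⟩
      add_mem' := by
        rintro f g ⟨x, hx⟩ ⟨y, hy⟩
        exact ⟨x + y, fun m => by simp [add_smul, hx, hy]⟩
      smul_mem' := by
        rintro c f ⟨x, hx⟩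
        refine ⟨c • x, fun m => ?_⟩
        rw [smul_assoc, hx]
        exact ((i.restrictScalars k).map_smul c _).symm }
  have hF : F = ⊥ := by
    by_contra hne
    obtain ⟨f, hf, hf0⟩ := F.ne_bot_iff.mp hne
    have htop := LinearMap.submodule_eq_top_of_sandwich_mem F hf hf0 (by
      rintro a b g ⟨x, hx⟩
      obtain ⟨y, rfl⟩ := toModuleEnd_surjective_of_isSimpleModule (k := k) (Γ := Γ) a
      obtain ⟨z, rfl⟩ := toModuleEnd_surjective_of_isSimpleModule (k := k) (Γ := Γ) b
      exact ⟨y * x * z, fun m => by simp [mul_smul, hx, sandwich_apply]⟩)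
    have h1 := finrank_eq_of_forall_exists_smul_eq hi hp hip hM hWN fun f => by
      have : f ∈ F := htop ▸ Submodule.mem_top
      exact this
    rw [hN.actTrace_eq, hsW, hsN, Nat.cast_mul] at h1
    have h2 : 2 * ((Module.finrank k N : k) * Module.finrank k W) = 0 := by
      linear_combination h1 - (Module.finrank k N * Module.finrank k W : k) * hs
    simp [hdN, hdW] at h2
  obtain ⟨e, heW, heN⟩ := exists_smul_eq_self_smul_eq_zero (k := k) hempty
  have hker (x : Γ) (hxW : ∀ w : W, x • w = 0) (hxN : ∀ n : N, x • n = 0) (m : M) :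
      x • m = 0 := by
    obtain ⟨t, ht⟩ := (p.restrictScalars k).exists_rightInverse_of_surjective
      (LinearMap.range_eq_top.mpr hp)
    obtain ⟨l, hl⟩ := (i.restrictScalars k).exists_leftInverse_of_injective
      (LinearMap.ker_eq_bot.mpr hi)
    have hx (m : M) : x • m = i (l (x • t (p m))) := by
      have hpt : p (t (p m)) = p m := LinearMap.congr_fun ht _
      obtain ⟨y, hy⟩ := (hip (m - t (p m))).mp (by rw [map_sub, hpt, sub_self])
      have h1 : x • m = x • t (p m) := by
        rw [← sub_eq_zero, ← smul_sub, ← hy, ← map_smul, hxW, map_zero]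
      obtain ⟨z, hz⟩ := (hip (x • m)).mp (by rw [map_smul, hxN])
      rw [← h1, ← hz]
      exact congrArg i (LinearMap.congr_fun hl z).symm
    have hmem : l ∘ₗ (Algebra.lsmul k k M x) ∘ₗ t ∈ F := ⟨x, hx⟩
    rw [hF, Submodule.mem_bot] at hmem
    rw [hx]
    exact (congrArg i (LinearMap.congr_fun hmem (p m))).trans (map_zero i)
  have hcomm (x : Γ) (m : M) : e • x • m = x • e • m := by
    rw [← sub_eq_zero, ← mul_smul, ← mul_smul, ← sub_smul]
    exact hker _ (fun w => by simp [sub_smul, mul_smul, heW])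
      (fun n => by simp [sub_smul, mul_smul, heN]) m
  have hidem (m : M) : e • e • m = e • m := by
    rw [← sub_eq_zero, ← mul_smul, ← sub_smul]
    exact hker _ (fun w => by simp [sub_smul, mul_smul, heW])
      (fun n => by simp [sub_smul, mul_smul, heN]) m
  refine ⟨{ carrier := {m | e • m = 0}
            zero_mem' := smul_zero e
            add_mem' := fun {a b} ha hb => by simp_all
            smul_mem' := fun x m hm => by simp_all }, ?_, ?_⟩
  · refine Submodule.disjoint_def.mpr ?_
    rintro _ ⟨w, rfl⟩ hw
    change e • i w = 0 at hw
    rwa [← map_smul, heW] at hw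
  · refine codisjoint_iff.mpr (eq_top_iff.mpr fun m _ => ?_)
    refine Submodule.mem_sup.mpr ⟨e • m, ?_, m - e • m, ?_, by simp⟩
    · exact (hip _).mp (by rw [map_smul, heN])
    · change e • (m - e • m) = 0
      rw [smul_sub, hidem, sub_self]

end KernelSplitting

section Lattice

variable {L : Type*} [Lattice L] [WellFoundedGT L]

lemma monotone_of_forall_covBy [WellFoundedLT L] {p : L → ℕ} (h : ∀ x y, x ⋖ y → p x ≤ p y) :
    Monotone p := fun x y => by
  induction y using WellFoundedLT.induction with
  | ind y ih =>
    intro hxy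
    obtain rfl | hlt := hxy.eq_or_lt
    · rfl
    · obtain ⟨z, hxz, hzy⟩ := exists_le_covBy_of_lt hlt
      exact (ih z hzy.lt hxz).trans (h z y hzy)

lemma eq_zero_of_unique_covBy {p n : L → ℕ} (hpm : Monotone p)
    (hpsup : ∀ x y, p (x ⊔ y) ≤ p x + p y) {x y : L} (hxy : n x = n y)
    (huniq : ∀ z, z < y → z ≤ x) {a b : L} (hab : a ⊔ b = x) (ha : n a = 0) (hb : p b = 0)
    (hex : ∀ x', x' ⋖ x → p x' = p x → ∃ z, x' ≤ z ∧ z < y ∧ ¬ z ≤ x) : n y = 0 := by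
  rw [← hxy]
  by_contra hx
  have hax : a < x := lt_of_le_of_ne (hab ▸ le_sup_left) fun h => hx (h ▸ ha)
  obtain ⟨x', hax', hx'⟩ := exists_le_covBy_of_lt hax
  have hp : p x' = p x := le_antisymm (hpm hx'.le) <|
    calc p x ≤ p a + p b := hab ▸ hpsup a b
      _ = p a := by rw [hb, add_zero]
      _ ≤ p x' := hpm hax'
  obtain ⟨z, -, hzy, hzx⟩ := hex x' hx' hp
  exact hzx (huniq z hzy)

/-- Let `p` and `n` be two dimension functions on a lattice such that each covering relation
increases exactly one of them. If coverings of different type can be exchanged, then each element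
is the join of an element with `n = 0` and one with `p = 0`. -/
lemma exists_sup_eq_of_exchange [OrderBot L] [WellFoundedLT L] {p n : L → ℕ}
    (hp0 : p ⊥ = 0) (hn0 : n ⊥ = 0)
    (hpsup : ∀ x y, p (x ⊔ y) ≤ p x + p y) (hnsup : ∀ x y, n (x ⊔ y) ≤ n x + n y)
    (hcov : ∀ x y, x ⋖ y → p x = p y ∧ n x ≤ n y ∨ n x = n y ∧ p x ≤ p y)
    (hex : ∀ x y z, x ⋖ y → y ⋖ z → (p x = p y ∧ n y = n z ∨ n x = n y ∧ p y = p z) →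
      ∃ w, x ≤ w ∧ w < z ∧ ¬ w ≤ y) (x : L) :
    ∃ a b, a ⊔ b = x ∧ n a = 0 ∧ p b = 0 := by
  have hpm : Monotone p := monotone_of_forall_covBy fun x y h => by
    rcases hcov x y h with h | h <;> lia
  have hnm : Monotone n := monotone_of_forall_covBy fun x y h => by
    rcases hcov x y h with h | h <;> lia
  induction x using WellFoundedLT.induction with
  | ind y ih =>
    obtain rfl | hy := eq_or_ne y ⊥
    · exact ⟨⊥, ⊥, by simp, hn0, hp0⟩
    obtain ⟨x, -, hxy⟩ := exists_le_covBy_of_lt (bot_lt_iff_ne_bot.mpr hy)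
    obtain ⟨a, b, hab, ha, hb⟩ := ih x hxy.lt
    by_cases huniq : ∀ z, z < y → z ≤ x
    · rcases hcov x y hxy with ⟨h, -⟩ | ⟨h, -⟩
      · have := eq_zero_of_unique_covBy hnm hnsup h huniq ((sup_comm b a).trans hab) hb ha
          fun x' hx' hn => hex x' x y hx' hxy (Or.inr ⟨hn, h⟩)
        exact ⟨⊥, y, by simp, hn0, this⟩
      · have := eq_zero_of_unique_covBy hpm hpsup h huniq hab ha hb
          fun x' hx' hp => hex x' x y hx' hxy (Or.inl ⟨hp, h⟩)
        exact ⟨y, ⊥, by simp, this, hp0⟩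
    · push Not at huniq
      obtain ⟨z, hzy, hzx⟩ := huniq
      obtain ⟨c, d, hcd, hc, hd⟩ := ih z hzy
      have hsup : x ⊔ z = y := (hxy.eq_or_eq le_sup_left (sup_le hxy.le hzy.le)).resolve_left
        fun h => hzx (h ▸ le_sup_right)
      refine ⟨a ⊔ c, b ⊔ d, ?_, ?_, ?_⟩
      · rw [sup_sup_sup_comm, hab, hcd, hsup]
      · have := hnsup a c
        lia
      · have := hpsup b d
        lia

end Lattice

section Subquotient

variable {Γ : Type*} [Ring Γ] [Algebra k Γ]
  {M : Type*} [AddCommGroup M] [Module k M] [Module Γ M] [IsScalarTower k Γ M]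
  [FiniteDimensional k M]

instance finiteDimensional_restrictScalars_submodule (P : Submodule Γ M) :
    FiniteDimensional k P :=
  FiniteDimensional.finiteDimensional_submodule (P.restrictScalars k)

instance finiteDimensional_restrictScalars_quotient (P : Submodule Γ M) :
    FiniteDimensional k (M ⧸ P) :=
  .of_surjective (P.mkQ.restrictScalars k) P.mkQ_surjective

/-- The subquotient `Q / (P ∩ Q)`. -/
abbrev Subquot (P Q : Submodule Γ M) : Type _ := Q ⧸ P.comap Q.subtype

lemma exact_inclusion_mkQ {P Q : Submodule Γ M} (h : P ≤ Q) :
    Function.Exact (Submodule.inclusion h) (P.comap Q.subtype).mkQ := fun q => by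
  simp only [Submodule.mkQ_apply, Submodule.Quotient.mk_eq_zero, Submodule.mem_comap,
    Submodule.subtype_apply]
  exact ⟨fun hq => ⟨⟨q, hq⟩, rfl⟩, by rintro ⟨p, rfl⟩; exact p.2⟩

lemma actTrace_eq_add_subquot {P Q : Submodule Γ M} (h : P ≤ Q) (x : Γ) :
    actTrace k Q x = actTrace k P x + actTrace k (Subquot P Q) x :=
  actTrace_eq_add_of_exact (Submodule.inclusion_injective h) (Submodule.mkQ_surjective _)
    (exact_inclusion_mkQ h) x

lemma finrank_eq_add_of_exact_of_tower {X Y Z : Type*} [AddCommGroup X] [Module k X] [Module Γ X]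
    [IsScalarTower k Γ X] [AddCommGroup Y] [Module k Y] [Module Γ Y] [IsScalarTower k Γ Y]
    [AddCommGroup Z] [Module k Z] [Module Γ Z] [IsScalarTower k Γ Z] [FiniteDimensional k X]
    [FiniteDimensional k Y] {i : X →ₗ[Γ] Y} {p : Y →ₗ[Γ] Z} (hi : Function.Injective i)
    (hp : Function.Surjective p) (hip : Function.Exact i p) :
    Module.finrank k Y = Module.finrank k X + Module.finrank k Z :=
  LinearMap.finrank_eq_add_of_exact (i := i.restrictScalars k) (p := p.restrictScalars k) hi hp hip

lemma finrank_eq_add_subquot {P Q : Submodule Γ M} (h : P ≤ Q) :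
    Module.finrank k Q = Module.finrank k P + Module.finrank k (Subquot P Q) :=
  finrank_eq_add_of_exact_of_tower (Submodule.inclusion_injective h) (Submodule.mkQ_surjective _)
    (exact_inclusion_mkQ h)

lemma actTrace_sup_add_actTrace_inf (P Q : Submodule Γ M) (x : Γ) :
    actTrace k (P ⊔ Q : Submodule Γ M) x + actTrace k (P ⊓ Q : Submodule Γ M) x =
      actTrace k P x + actTrace k Q x := by
  have h1 := actTrace_eq_add_subquot (k := k) (inf_le_left : P ⊓ Q ≤ P) x
  have h2 := actTrace_eq_add_subquot (k := k) (le_sup_right : Q ≤ P ⊔ Q) x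
  have e : Subquot (P ⊓ Q) P ≃ₗ[Γ] Subquot Q (P ⊔ Q) := LinearMap.quotientInfEquivSupQuotient P Q
  have h3 := actTrace_congr (k := k) e x
  linear_combination h2 - h1 - h3

lemma finrank_sup_add_finrank_inf (P Q : Submodule Γ M) :
    Module.finrank k (P ⊔ Q : Submodule Γ M) + Module.finrank k (P ⊓ Q : Submodule Γ M) =
      Module.finrank k P + Module.finrank k Q := by
  have h1 := finrank_eq_add_subquot (k := k) (inf_le_left : P ⊓ Q ≤ P)
  have h2 := finrank_eq_add_subquot (k := k) (le_sup_right : Q ≤ P ⊔ Q)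
  have h3 : Module.finrank k (Subquot (P ⊓ Q) P) = Module.finrank k (Subquot Q (P ⊔ Q)) :=
    ((LinearMap.quotientInfEquivSupQuotient P Q).restrictScalars k).finrank_eq
  lia

/-- If `Y / X` has a complement in `Z / X`, there is a proper submodule of `Z` that contains `X`
and is not contained in `Y`. -/
lemma exists_lt_not_le_of_isCompl {X Y Z : Submodule Γ M} (hXY : X < Y) (hYZ : Y < Z)
    {C : Submodule Γ (Subquot X Z)}
    (hC : IsCompl ((Y.comap Z.subtype).map (X.comap Z.subtype).mkQ) C) :
    ∃ P, X ≤ P ∧ P < Z ∧ ¬ P ≤ Y := by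
  have hmem (z : Z) : z ∈ C.comap (X.comap Z.subtype).mkQ ↔
      (z : M) ∈ (C.comap (X.comap Z.subtype).mkQ).map Z.subtype := by simp
  have hXZ := hXY.trans hYZ
  refine ⟨(C.comap (X.comap Z.subtype).mkQ).map Z.subtype, ?_, ?_, ?_⟩
  · intro x hx
    refine (hmem ⟨x, hXZ.le hx⟩).mp ?_
    have : (X.comap Z.subtype).mkQ ⟨x, hXZ.le hx⟩ = 0 :=
      (Submodule.Quotient.mk_eq_zero _).mpr hx
    rw [Submodule.mem_comap, this]
    exact C.zero_mem
  · refine lt_of_le_of_ne (Submodule.map_subtype_le _ _) fun h => ?_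
    refine hXY.not_ge fun y hy => ?_
    have h1 := (hmem ⟨y, hYZ.le hy⟩).mpr (h.symm ▸ hYZ.le hy)
    have h2 := Submodule.disjoint_def.mp hC.disjoint _
      ⟨⟨y, hYZ.le hy⟩, hy, rfl⟩ h1
    exact (Submodule.Quotient.mk_eq_zero (X.comap Z.subtype)).mp h2
  · refine fun h => hYZ.not_ge fun z hz => ?_
    obtain ⟨a, ⟨y, hy, rfl⟩, c, hc, hac⟩ := Submodule.mem_sup.mp
      (hC.sup_eq_top ▸ Submodule.mem_top : (X.comap Z.subtype).mkQ ⟨z, hz⟩ ∈ _ ⊔ C)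
    have h1 : (⟨z, hz⟩ - y : Z) ∈ C.comap (X.comap Z.subtype).mkQ := by
      rw [Submodule.mem_comap, map_sub, ← hac, add_sub_cancel_left]
      exact hc
    have h2 := Y.add_mem (h ((hmem _).mp h1)) hy
    simpa using h2

/-- Consecutive coverings of submodules whose simple subquotients have opposite sign can be
exchanged. -/
lemma exists_lt_not_le_of_sign [IsAlgClosed k] [CharZero k] {X Y Z : Submodule Γ M}
    (hXY : X ⋖ Y) (hYZ : Y ⋖ Z) {w v : Γ} (hXZ : IsInvolutivePair k (Subquot X Z) w v)
    (hprod : IsInvolutivePair k (Subquot X Y × Subquot Y Z) w v)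
    (hN : IsInvolutivePair k (Subquot Y Z) w v) {s : k} (hs : s * s = 1)
    (hsW : actTrace k (Subquot X Y) w = s * Module.finrank k (Subquot X Y))
    (hsN : actTrace k (Subquot Y Z) w = -(s * Module.finrank k (Subquot Y Z))) :
    ∃ P, X ≤ P ∧ P < Z ∧ ¬ P ≤ Y := by
  have : IsSimpleModule Γ (Subquot X Y) := (covBy_iff_quot_is_simple hXY.le).mp hXY
  have : IsSimpleModule Γ (Subquot Y Z) := (covBy_iff_quot_is_simple hYZ.le).mp hYZ
  let i : Subquot X Y →ₗ[Γ] Subquot X Z :=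
    Submodule.mapQ _ _ (Submodule.inclusion hYZ.le) fun y hy => hy
  have hle : X.comap Z.subtype ≤ Y.comap Z.subtype := Submodule.comap_mono hXY.le
  have hrange : LinearMap.range i = (Y.comap Z.subtype).map (X.comap Z.subtype).mkQ := by
    ext q
    constructor
    · rintro ⟨q, rfl⟩
      obtain ⟨y, rfl⟩ := Submodule.Quotient.mk_surjective _ q
      exact ⟨Submodule.inclusion hYZ.le y, y.2, rfl⟩
    · rintro ⟨z, hz, rfl⟩
      exact ⟨Submodule.Quotient.mk ⟨z, hz⟩, rfl⟩
  have hi : Function.Injective i := by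
    rw [← LinearMap.ker_eq_bot, Submodule.eq_bot_iff]
    intro q hq
    obtain ⟨y, rfl⟩ := Submodule.Quotient.mk_surjective _ q
    exact (Submodule.Quotient.mk_eq_zero _).mpr ((Submodule.Quotient.mk_eq_zero (X.comap Z.subtype)).mp
      (show (Submodule.Quotient.mk (Submodule.inclusion hYZ.le y) : Subquot X Z) = 0 from hq))
  have hex : Function.Exact i (Submodule.factor hle) := fun q => by
    obtain ⟨z, rfl⟩ := Submodule.Quotient.mk_surjective _ q
    change Submodule.Quotient.mk z = 0 ↔ _
    rw [Submodule.Quotient.mk_eq_zero]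
    constructor
    · exact fun hz => ⟨Submodule.Quotient.mk ⟨z, hz⟩, rfl⟩
    · rintro ⟨q, hq⟩
      obtain ⟨y, rfl⟩ := Submodule.Quotient.mk_surjective _ q
      have h1 := (Submodule.Quotient.eq _).mp hq
      have h2 := Y.sub_mem y.2 (hXY.le h1)
      simpa using h2
  obtain ⟨C, hC⟩ := exists_isCompl_range_of_sign hi (Submodule.factor_surjective hle) hex hXZ
    hprod hN hs hsW hsN
  rw [hrange] at hC
  exact exists_lt_not_le_of_isCompl hXY.lt hYZ.lt hC

end Subquotient

section SignDecomposition

variable {Γ : Type*} [Ring Γ] [Algebra k Γ]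
  {M : Type*} [AddCommGroup M] [Module k M] [Module Γ M] [IsScalarTower k Γ M] {w v : Γ}

lemma actTrace_bot (x : Γ) : actTrace k (⊥ : Submodule Γ M) x = 0 := by
  rw [actTrace, Subsingleton.elim (Algebra.lsmul k k (⊥ : Submodule Γ M) x) 0, map_zero]

variable [IsAlgClosed k] [FiniteDimensional k M]

lemma actTrace_of_covBy {P Q : Submodule Γ M} (h : P ⋖ Q)
    (hPQ : IsInvolutivePair k (Subquot P Q) w v) :
    actTrace k (Subquot P Q) w = Module.finrank k (Subquot P Q) ∨
      actTrace k (Subquot P Q) w = -Module.finrank k (Subquot P Q) := by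
  have : IsSimpleModule Γ (Subquot P Q) := (covBy_iff_quot_is_simple h.le).mp h
  exact hPQ.actTrace_of_isSimpleModule

variable [CharZero k]

lemma exists_nat_actTrace_eq_sub (h : ∀ P Q : Submodule Γ M, IsInvolutivePair k (Subquot P Q) w v)
    (Q : Submodule Γ M) : ∃ p n : ℕ, actTrace k Q w = p - n ∧ Module.finrank k Q = p + n := by
  have : IsArtinian Γ M := isArtinian_of_tower k inferInstance
  have : IsNoetherian Γ M := isNoetherian_of_tower k inferInstance
  induction Q using WellFoundedLT.induction with
  | ind Q ih =>
    obtain rfl | hQ := eq_or_ne Q ⊥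
    · refine ⟨0, 0, by simp [actTrace_bot], ?_⟩
      exact Module.finrank_zero_of_subsingleton
    obtain ⟨P, -, hPQ⟩ := exists_le_covBy_of_lt (bot_lt_iff_ne_bot.mpr hQ)
    obtain ⟨p, n, hp, hn⟩ := ih P hPQ.lt
    rw [actTrace_eq_add_subquot hPQ.le, finrank_eq_add_subquot hPQ.le, hp, hn]
    rcases actTrace_of_covBy hPQ (h P Q) with h1 | h1
    · exact ⟨p + Module.finrank k (Subquot P Q), n, by rw [h1]; push_cast; ring, by ring⟩
    · exact ⟨p, n + Module.finrank k (Subquot P Q), by rw [h1]; push_cast; ring, by ring⟩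

/-- If all subquotients of `M` and their products are involutive, then `M` is the direct sum of
its largest submodules on which the trace of `w` is plus, respectively minus, the dimension. -/
lemma exists_isCompl_of_isInvolutivePair
    (h : ∀ P Q : Submodule Γ M, IsInvolutivePair k (Subquot P Q) w v)
    (hprod : ∀ P Q P' Q' : Submodule Γ M,
      IsInvolutivePair k (Subquot P Q × Subquot P' Q') w v) :
    ∃ P N : Submodule Γ M, IsCompl P N ∧
      (∀ Q : Submodule Γ M, actTrace k Q w = Module.finrank k Q ↔ Q ≤ P) ∧
      ∀ Q : Submodule Γ M, actTrace k Q w = -Module.finrank k Q ↔ Q ≤ N := by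
  have : IsArtinian Γ M := isArtinian_of_tower k inferInstance
  have : IsNoetherian Γ M := isNoetherian_of_tower k inferInstance
  choose p n ht hd using exists_nat_actTrace_eq_sub h
  have hdk (Q : Submodule Γ M) : (Module.finrank k Q : k) = p Q + n Q := by simp [hd]
  have two : (2 : k) ≠ 0 := two_ne_zero
  have hpos (Q : Submodule Γ M) : actTrace k Q w = Module.finrank k Q ↔ n Q = 0 := by
    rw [ht, hdk, ← Nat.cast_inj (R := k), Nat.cast_zero]
    constructor
    · intro h
      refine (mul_eq_zero.mp (?_ : 2 * (n Q : k) = 0)).resolve_left two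
      linear_combination -h
    · intro h
      rw [h]
      ring
  have hneg (Q : Submodule Γ M) : actTrace k Q w = -Module.finrank k Q ↔ p Q = 0 := by
    rw [ht, hdk, ← Nat.cast_inj (R := k), Nat.cast_zero]
    constructor
    · intro h
      refine (mul_eq_zero.mp (?_ : 2 * (p Q : k) = 0)).resolve_left two
      linear_combination h
    · intro h
      rw [h]
      ring
  have hdle {P Q : Submodule Γ M} (hPQ : P ≤ Q) : p P + n P ≤ p Q + n Q := by
    rw [← hd, ← hd, finrank_eq_add_subquot hPQ]
    exact Nat.le_add_right _ _
  have hbot : p ⊥ + n ⊥ = 0 := by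
    rw [← hd]
    exact Module.finrank_zero_of_subsingleton
  have hmod (P Q : Submodule Γ M) :
      p (P ⊔ Q) + p (P ⊓ Q) = p P + p Q ∧ n (P ⊔ Q) + n (P ⊓ Q) = n P + n Q := by
    have h1 := actTrace_sup_add_actTrace_inf (k := k) P Q w
    have h2 := finrank_sup_add_finrank_inf (k := k) P Q
    simp only [ht] at h1
    simp only [hd] at h2
    have h3 : p (P ⊔ Q) + p (P ⊓ Q) + n P + n Q = p P + p Q + n (P ⊔ Q) + n (P ⊓ Q) := by
      rw [← Nat.cast_inj (R := k)]
      push_cast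
      linear_combination h1
    lia
  have hsubquot {P Q : Submodule Γ M} (hPQ : P ≤ Q) :
      actTrace k (Subquot P Q) w = p Q - n Q - (p P - n P) ∧
        (Module.finrank k (Subquot P Q) : k) = p Q + n Q - (p P + n P) := by
    have h1 := actTrace_eq_add_subquot (k := k) hPQ w
    have h2 := congrArg (Nat.cast (R := k)) (finrank_eq_add_subquot (k := k) hPQ)
    rw [Nat.cast_add, hdk, hdk] at h2
    rw [ht, ht] at h1
    exact ⟨by linear_combination -h1, by linear_combination -h2⟩
  have hcov (P Q : Submodule Γ M) (hPQ : P ⋖ Q) :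
      p P = p Q ∧ n P ≤ n Q ∨ n P = n Q ∧ p P ≤ p Q := by
    obtain ⟨h1, h2⟩ := hsubquot hPQ.le
    have h3 := hdle hPQ.le
    rcases actTrace_of_covBy hPQ (h P Q) with h4 | h4 <;> rw [h1, h2] at h4
    · have h5 : n P = n Q := by
        rw [← Nat.cast_inj (R := k)]
        refine mul_left_cancel₀ two ?_
        linear_combination h4
      lia
    · have h5 : p P = p Q := by
        rw [← Nat.cast_inj (R := k)]
        refine mul_left_cancel₀ two ?_
        linear_combination -h4
      lia
  have hpm : Monotone p := monotone_of_forall_covBy fun x y h => by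
    rcases hcov x y h with h | h <;> lia
  have hnm : Monotone n := monotone_of_forall_covBy fun x y h => by
    rcases hcov x y h with h | h <;> lia
  have hdisj {P Q : Submodule Γ M} (hP : n P = 0) (hQ : p Q = 0) : Disjoint P Q := by
    rw [disjoint_iff]
    have h1 := hpm (inf_le_right : P ⊓ Q ≤ Q)
    have h2 := hnm (inf_le_left : P ⊓ Q ≤ P)
    have h3 := hd (P ⊓ Q)
    have h4 : Subsingleton (P ⊓ Q : Submodule Γ M) :=
      Module.finrank_zero_iff.mp (show Module.finrank k (P ⊓ Q : Submodule Γ M) = 0 by lia)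
    exact Submodule.subsingleton_iff_eq_bot.mp h4
  obtain ⟨P, N, hPN, hP, hN⟩ := exists_sup_eq_of_exchange (by lia : p ⊥ = 0) (by lia : n ⊥ = 0)
    (fun x y => by have := hmod x y; lia) (fun x y => by have := hmod x y; lia) hcov
    (fun x y z hxy hyz hs => by
      obtain ⟨h1, h2⟩ := hsubquot hxy.le
      obtain ⟨h3, h4⟩ := hsubquot hyz.le
      rcases hs with ⟨h5, h6⟩ | ⟨h5, h6⟩
      · refine exists_lt_not_le_of_sign hxy hyz (h x z) (hprod x y y z) (h y z) (s := -1) (by ring)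
          ?_ ?_
        · rw [h1, h2, h5]
          ring
        · rw [h3, h4, h6]
          ring
      · refine exists_lt_not_le_of_sign hxy hyz (h x z) (hprod x y y z) (h y z) (s := 1) (by ring)
          ?_ ?_
        · rw [h1, h2, h5]
          ring
        · rw [h3, h4, h6]
          ring) (⊤ : Submodule Γ M)
  refine ⟨P, N, ⟨hdisj hP hN, codisjoint_iff.mpr hPN⟩, fun Q => ?_, fun Q => ?_⟩
  · rw [hpos]
    refine ⟨fun hQ => ?_, fun hQ => by have := hnm hQ; lia⟩
    have h1 := hmod Q P
    have h2 : Disjoint (P ⊔ Q) N := hdisj (by rw [sup_comm]; lia) hN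
    have h3 := sup_inf_assoc_of_le N (le_sup_left : P ≤ P ⊔ Q)
    rw [hPN, top_inf_eq, inf_comm, disjoint_iff.mp h2, sup_bot_eq] at h3
    exact h3 ▸ le_sup_right
  · rw [hneg]
    refine ⟨fun hQ => ?_, fun hQ => by have := hpm hQ; lia⟩
    have h1 := hmod Q N
    have h2 : Disjoint P (N ⊔ Q) := hdisj hP (by rw [sup_comm]; lia)
    have h3 := sup_inf_assoc_of_le P (le_sup_left : N ≤ N ⊔ Q)
    rw [sup_comm, hPN, top_inf_eq, disjoint_iff.mp h2, sup_bot_eq] at h3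
    exact h3 ▸ le_sup_right

end SignDecomposition

section RationalDecomposition

variable {M : Type*} [AddCommGroup M] [Module k M] [Module (DualAlg k A) M]
  [IsScalarTower k (DualAlg k A) M]

lemma IsRational.submodule (hM : IsRational k A M) (Q : Submodule (DualAlg k A) M) :
    IsRational k A Q :=
  hM.of_injective (Q.subtype.restrictScalars k) Q.injective_subtype
    fun f m => Q.subtype.map_smul f m

lemma IsRational.quotient (hM : IsRational k A M) (Q : Submodule (DualAlg k A) M) :
    IsRational k A (M ⧸ Q) :=
  hM.of_surjective (Q.mkQ.restrictScalars k) Q.mkQ_surjective fun f m => Q.mkQ.map_smul f m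

lemma IsRational.exists_isCompl [IsAlgClosed k] [CharZero k] [FiniteDimensional k M]
    (hM : IsRational k A M) {R : A ⊗[k] A →ₗ[k] k} (hR : IsCT (mul' k A) R)
    (hpi : Pseudoinvolutive k A) :
    ∃ P N : Submodule (DualAlg k A) M, IsCompl P N ∧
      (∀ Q : Submodule (DualAlg k A) M,
        actTrace k Q (WithConv.toConv (drinfeld R) : DualAlg k A) = Module.finrank k Q ↔ Q ≤ P) ∧
      ∀ Q : Submodule (DualAlg k A) M,
        actTrace k Q (WithConv.toConv (drinfeld R) : DualAlg k A) = -Module.finrank k Q ↔ Q ≤ N :=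
  have h (P Q : Submodule (DualAlg k A) M) : IsRational k A (Subquot P Q) :=
    (hM.submodule Q).quotient _
  exists_isCompl_of_isInvolutivePair (fun P Q => (h P Q).isInvolutivePair hR hpi)
    fun P Q P' Q' => ((h P Q).prod (h P' Q')).isInvolutivePair hR hpi

end RationalDecomposition

section Comodule

variable {V : Type u} [AddCommGroup V] [Module k V] {ρ : V →ₗ[k] V ⊗[k] A}

lemma apply_coact (φ : V →ₗ[k] k) (f : A →ₗ[k] k) (x : V) :
    φ (coact ρ f x) = mul' k k (map φ f (ρ x)) := by
  rw [coact, comp_apply, comp_apply]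
  induction ρ x with
  | zero => simp
  | tmul v a => simp [mul_comm]
  | add s t hs ht => simp only [map_add, hs, ht]

lemma IsComod.coact_conv1 (hρ : IsComod V ρ) (f g : A →ₗ[k] k) :
    coact ρ (conv1 f g) = coact ρ f ∘ₗ coact ρ g := by
  let F : V ⊗[k] (A ⊗[k] A) →ₗ[k] V := TensorProduct.rid k V ∘ₗ map .id (mul' k k ∘ₗ map f g)
  have h1 : coact ρ (conv1 f g) = F ∘ₗ map .id Coalgebra.comul ∘ₗ ρ := by
    rw [← comp_assoc, comp_assoc (map LinearMap.id Coalgebra.comul), ← map_comp]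
    rfl
  rw [h1, ← hρ.coassoc]
  ext x
  simp only [comp_apply, coact]
  induction ρ x with
  | zero => simp
  | add s t hs ht => simp only [map_add, hs, ht]
  | tmul v a =>
    simp only [map_tmul, id_apply, LinearEquiv.coe_coe, rid_tmul, map_smul]
    induction ρ v with
    | zero => simp
    | add s t hs ht => simp only [map_add, add_tmul, hs, ht, smul_add]
    | tmul v b => simp [F, smul_smul, mul_comm]

/-- The action of the convolution algebra `A*` on a right `A`-comodule. -/
def IsComod.coactHom (hρ : IsComod V ρ) : DualAlg k A →+* Module.End k V where
  toFun f := coact ρ f.ofConv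
  map_one' := hρ.counit_id
  map_mul' f g := hρ.coact_conv1 f.ofConv g.ofConv
  map_zero' := by ext; simp [coact]
  map_add' f g := by ext; simp [coact, map_add_right]

lemma isSubcomod_iff_forall_coact_mem {W : Submodule k V} :
    IsSubcomod ρ W ↔ ∀ f, ∀ x ∈ W, coact ρ f x ∈ W := by
  constructor
  · intro h f x hx
    obtain ⟨t, ht⟩ := h x hx
    rw [coact, comp_apply, comp_apply, ← ht]
    clear ht
    induction t with
    | zero => simp
    | tmul w a => simpa using W.smul_mem _ w.2
    | add s t hs ht =>
      simp only [map_add]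
      exact W.add_mem hs ht
  · intro h x hx
    refine (rTensor_exact A (LinearMap.exact_subtype_mkQ W) W.mkQ_surjective _).mp ?_
    refine TensorProduct.eq_of_forall_map_eq fun φ f => ?_
    have h1 := apply_coact (ρ := ρ) (φ ∘ₗ W.mkQ) f x
    rw [comp_apply, Submodule.mkQ_apply, (Submodule.Quotient.mk_eq_zero W).mpr (h f x hx),
      map_zero] at h1
    rw [map_zero, map_zero, LinearMap.rTensor, ← comp_apply (map φ f), ← map_comp, comp_id]
    exact h1.symm

end Comodule

section

/-- For a pseudoinvolutive cotriangular Hopf algebra `(A, R)` with Drinfeld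
element `u`, every finite-dimensional right `A`-comodule decomposes as `V = V₊ ⊕ V₋` with `V₊`
a positive and `V₋` a negative subcomodule; moreover `V₊` is the sum of all positive
subcomodules of `V` and `V₋` is the sum of all negative subcomodules of `V`. -/
theorem statement3 {k A : Type u} [Field k] [IsAlgClosed k] [CharZero k]
    [Ring A] [HopfAlgebra k A]
    (R : A ⊗[k] A →ₗ[k] k) (hR : IsCT (mul' k A) R)
    (hpi : Pseudoinvolutive k A)
    (V : Type u) [AddCommGroup V] [Module k V] [FiniteDimensional k V]
    (ρ : V →ₗ[k] V ⊗[k] A) (hρ : IsComod V ρ) :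
    ∃ Vp Vn : Submodule k V,
      IsSubcomod ρ Vp ∧ IsSubcomod ρ Vn ∧ IsCompl Vp Vn ∧
      SubPos ρ (drinfeld R) Vp ∧ SubNeg ρ (drinfeld R) Vn ∧
      Vp = sSup {W : Submodule k V | IsSubcomod ρ W ∧ SubPos ρ (drinfeld R) W} ∧
      Vn = sSup {W : Submodule k V | IsSubcomod ρ W ∧ SubNeg ρ (drinfeld R) W} := by
  let : Module (DualAlg k A) V := Module.compHom V hρ.coactHom
  have hsmul (f : DualAlg k A) (x : V) : f • x = coact ρ f.ofConv x := rfl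
  have : IsScalarTower k (DualAlg k A) V := ⟨fun c f x => by
    simp [hsmul, coact, map_smul_right]⟩
  have hV : IsRational k A V := fun x φ =>
    ⟨TensorProduct.lid k A (map φ .id (ρ x)), fun f => by
      rw [hsmul, apply_coact]
      induction ρ x with
      | zero => simp
      | tmul v a => simp
      | add s t hs ht => simp only [map_add, hs, ht]⟩
  have hsub (Q : Submodule (DualAlg k A) V) : IsSubcomod ρ (Q.restrictScalars k) :=
    isSubcomod_iff_forall_coact_mem.mpr fun f x hx => Q.smul_mem (WithConv.toConv f) hx
  have hlift {W : Submodule k V} (hW : IsSubcomod ρ W) :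
      ∃ Q : Submodule (DualAlg k A) V, Q.restrictScalars k = W :=
    ⟨{ W with smul_mem' := fun f x hx => isSubcomod_iff_forall_coact_mem.mp hW f.ofConv x hx }, rfl⟩
  obtain ⟨P, N, hPN, hP, hN⟩ := hV.exists_isCompl hR hpi
  have hpos (Q : Submodule (DualAlg k A) V) :
      SubPos ρ (drinfeld R) (Q.restrictScalars k) ↔ Q ≤ P := by
    rw [← hP]
    exact ⟨fun ⟨_, h⟩ => h, fun h => ⟨fun x hx => Q.smul_mem (WithConv.toConv (drinfeld R)) hx, h⟩⟩
  have hneg (Q : Submodule (DualAlg k A) V) :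
      SubNeg ρ (drinfeld R) (Q.restrictScalars k) ↔ Q ≤ N := by
    rw [← hN]
    exact ⟨fun ⟨_, h⟩ => h, fun h => ⟨fun x hx => Q.smul_mem (WithConv.toConv (drinfeld R)) hx, h⟩⟩
  refine ⟨P.restrictScalars k, N.restrictScalars k, hsub P, hsub N, ?_, (hpos P).mpr le_rfl,
    (hneg N).mpr le_rfl, ?_, ?_⟩
  · rw [isCompl_iff, disjoint_iff, codisjoint_iff]
    exact ⟨SetLike.ext fun x => SetLike.ext_iff.mp hPN.inf_eq_bot x, by
      rw [← Submodule.restrictScalars_sup, hPN.sup_eq_top, Submodule.restrictScalars_top]⟩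
  · refine le_antisymm (le_sSup ⟨hsub P, (hpos P).mpr le_rfl⟩) (sSup_le ?_)
    rintro W ⟨hW, hW'⟩
    obtain ⟨Q, rfl⟩ := hlift hW
    exact (hpos Q).mp hW'
  · refine le_antisymm (le_sSup ⟨hsub N, (hneg N).mpr le_rfl⟩) (sSup_le ?_)
    rintro W ⟨hW, hW'⟩
    obtain ⟨Q, rfl⟩ := hlift hW
    exact (hneg Q).mp hW'

end

end
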